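/- Let X be a geodesic δ-hyperbolic metric space (δ ≥ 0), let C₁ and C₂ be convex subsets of X with C₁ ∩ C₂ ≠ ∅, and let z ∈ X. Let x₁ ∈ C₁ and x₂ ∈ C₂ be points with d(z,x₁) ≤ d(z,C₁) + δ and d(z,x₂) ≤ d(z,C₂) + δ, and assume d(z,x₁) ≥ d(z,x₂) − δ. Then d(x₁, C₂) ≤ 28δ. -/

import Mathlib

open Pointwise Filter

/-- The joint displacement of a set of isometries at a point:
`L(S,x) = max_{s ∈ S} d(x, s x)`. -/
noncomputable def jointDispAt {X : Type*} [MetricSpace X] (S : Set (X ≃ᵢ X)) (x : X) : ℝ :=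
  sSup ((fun s : X ≃ᵢ X => dist x (s x)) '' S)

/-- The joint minimal displacement `L(S) = inf_x L(S,x)`. -/
noncomputable def jointMinDisp {X : Type*} [MetricSpace X] (S : Set (X ≃ᵢ X)) : ℝ :=
  sInf (Set.range (jointDispAt S))

/-- The asymptotic joint displacement `ℓ(S) = lim_n L(S^n)/n`; the limit exists by
subadditivity, hence agrees with the `limsup` used here. -/
noncomputable def asympDisp {X : Type*} [MetricSpace X] (S : Set (X ≃ᵢ X)) : ℝ :=
  Filter.limsup (fun n : ℕ => jointMinDisp (S ^ n) / n) Filter.atTop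

/-- `λ(S) = max_{s ∈ S} ℓ(s)`. -/
noncomputable def lamD {X : Type*} [MetricSpace X] (S : Set (X ≃ᵢ X)) : ℝ :=
  sSup ((fun s : X ≃ᵢ X => asympDisp {s}) '' S)

/-- `λ_k(S) = max_{1 ≤ j ≤ k} λ(S^j)/j`. -/
noncomputable def lamK {X : Type*} [MetricSpace X] (k : ℕ) (S : Set (X ≃ᵢ X)) : ℝ :=
  sSup ((fun j : ℕ => lamD (S ^ j) / j) '' Set.Icc 1 k)

/-- `λ_∞(S) = sup_{j ≥ 1} λ(S^j)/j`. -/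
noncomputable def lamInf {X : Type*} [MetricSpace X] (S : Set (X ≃ᵢ X)) : ℝ :=
  sSup ((fun j : ℕ => lamD (S ^ j) / j) '' Set.Ici 1)

/-- A geodesic segment from `a` to `b`: an isometric image of the interval `[0, d(a,b)]`. -/
def IsGeodesicSegment {X : Type*} [MetricSpace X] (s : Set X) (a b : X) : Prop :=
  ∃ f : ℝ → X, f 0 = a ∧ f (dist a b) = b ∧
    (∀ u ∈ Set.Icc (0 : ℝ) (dist a b), ∀ v ∈ Set.Icc (0 : ℝ) (dist a b),
      dist (f u) (f v) = |u - v|) ∧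
    s = f '' Set.Icc (0 : ℝ) (dist a b)

/-- A geodesic metric space: every two points are joined by a geodesic segment. -/
def GeodesicSpace (X : Type*) [MetricSpace X] : Prop :=
  ∀ a b : X, ∃ s : Set X, IsGeodesicSegment s a b

/-- `δ`-hyperbolicity: every geodesic triangle is `δ`-thin, i.e. each side is contained in
the closed `δ`-neighborhood of the union of the other two sides. -/
def GromovHyperbolic (X : Type*) [MetricSpace X] (δ : ℝ) : Prop :=
  ∀ a b c : X, ∀ sab sbc sca : Set X,
    IsGeodesicSegment sab a b → IsGeodesicSegment sbc b c → IsGeodesicSegment sca c a →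
      (∀ x ∈ sab, ∃ y ∈ sbc ∪ sca, dist x y ≤ δ) ∧
      (∀ x ∈ sbc, ∃ y ∈ sab ∪ sca, dist x y ≤ δ) ∧
      (∀ x ∈ sca, ∃ y ∈ sab ∪ sbc, dist x y ≤ δ)

/-- The CAT(0) comparison inequality: for all `a b c` and every midpoint `m` of a geodesic
from `b` to `c`, `2 d(a,m)² ≤ d(a,b)² + d(a,c)² - d(b,c)²/2`. -/
def CAT0 (X : Type*) [MetricSpace X] : Prop :=
  ∀ a b c m : X, dist b m = dist b c / 2 → dist m c = dist b c / 2 →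
    2 * dist a m ^ 2 ≤ dist a b ^ 2 + dist a c ^ 2 - dist b c ^ 2 / 2

/-- A subset is (geodesically) convex if every geodesic segment between two of its points is
contained in it. -/
def GeodConvex {X : Type*} [MetricSpace X] (C : Set X) : Prop :=
  ∀ a ∈ C, ∀ b ∈ C, ∀ s : Set X, IsGeodesicSegment s a b → s ⊆ C

/-- Translation length `L(g) = inf_x d(x, g x)`. -/
noncomputable def transLen {X : Type*} [MetricSpace X] (g : X ≃ᵢ X) : ℝ :=
  sInf (Set.range fun x : X => dist x (g x))

/-- Asymptotic translation length `ℓ(g) = lim_n L(g^n)/n`. -/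
noncomputable def asympTransLen {X : Type*} [MetricSpace X] (g : X ≃ᵢ X) : ℝ :=
  Filter.limsup (fun n : ℕ => transLen (g ^ n) / n) Filter.atTop

/-- A geodesic segment from `a` to `b` contains `b`. -/
lemma IsGeodesicSegment.right_mem {X : Type*} [MetricSpace X] {s : Set X} {a b : X}
    (h : IsGeodesicSegment s a b) : b ∈ s := by
  obtain ⟨f, -, hb, -, rfl⟩ := h
  exact ⟨dist a b, ⟨dist_nonneg, le_rfl⟩, hb⟩

/-- Distances to the endpoints of a geodesic segment add up to its length. -/
lemma IsGeodesicSegment.dist_add_dist {X : Type*} [MetricSpace X] {s : Set X} {a b p : X}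
    (h : IsGeodesicSegment s a b) (hp : p ∈ s) : dist a p + dist p b = dist a b := by
  obtain ⟨f, ha, hb, hf, rfl⟩ := h
  obtain ⟨u, hu, rfl⟩ := hp
  have h₁ := hf 0 ⟨le_rfl, dist_nonneg⟩ u hu
  have h₂ := hf u hu (dist a b) ⟨dist_nonneg, le_rfl⟩
  rw [ha, zero_sub, abs_neg, abs_of_nonneg hu.1] at h₁
  rw [hb, abs_of_nonpos (sub_nonpos.2 hu.2)] at h₂
  linarith

/-- A geodesic segment contains points at any admissible distance from its endpoint. -/
lemma IsGeodesicSegment.exists_dist_right_eq {X : Type*} [MetricSpace X] {s : Set X} {a b : X}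
    (h : IsGeodesicSegment s a b) {t : ℝ} (ht₀ : 0 ≤ t) (ht : t ≤ dist a b) :
    ∃ p ∈ s, dist p b = t := by
  obtain ⟨f, ha, hb, hf, rfl⟩ := h
  have hu : dist a b - t ∈ Set.Icc (0 : ℝ) (dist a b) := ⟨by linarith, by linarith⟩
  refine ⟨_, ⟨_, hu, rfl⟩, ?_⟩
  have h₂ := hf _ hu (dist a b) ⟨dist_nonneg, le_rfl⟩
  rw [hb, sub_sub_cancel_left, abs_neg, abs_of_nonneg ht₀] at h₂
  exact h₂

/-- A geodesic from a point of a convex set `C` to `z` passes close to every almost-nearest point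
of `C` to `z`. -/
lemma GeodConvex.exists_mem_segment_dist_le {X : Type*} [MetricSpace X] {δ ε : ℝ}
    (hδ : 0 ≤ δ) (hgeo : GeodesicSpace X) (hhyp : GromovHyperbolic X δ) {C : Set X}
    (hC : GeodConvex C) {x y z : X} (hx : x ∈ C) (hy : y ∈ C)
    (hn : dist z x ≤ Metric.infDist z C + δ) {s : Set X} (hs : IsGeodesicSegment s y z)
    (hε : 0 < ε) : ∃ r ∈ s, dist x r ≤ 3 * δ + ε := by
  rcases lt_or_ge (dist z x) (2 * δ + ε) with hlt | hge
  · exact ⟨z, hs.right_mem, by rw [dist_comm]; linarith⟩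
  obtain ⟨szx, hzx⟩ := hgeo z x
  obtain ⟨sxy, hxy⟩ := hgeo x y
  obtain ⟨p, hp, hpx⟩ := hzx.exists_dist_right_eq (by linarith) hge
  obtain ⟨q, hq | hq, hpq⟩ := (hhyp z x y szx sxy s hzx hxy hs).1 p hp
  · have h₁ := Metric.infDist_le_dist_of_mem (x := z) (hC x hx y hy sxy hxy hq)
    linarith [hzx.dist_add_dist hp, dist_triangle z p q]
  · exact ⟨q, hq, by linarith [dist_triangle x p q, dist_comm x p]⟩

/-- In a geodesic `δ`-hyperbolic space, let `C₁, C₂` be convex sets with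
nonempty intersection, `z` a point, and `xᵢ ∈ Cᵢ` almost-nearest points to `z` (within `δ`).
If `d(z,x₁) ≥ d(z,x₂) − δ` then `d(x₁, C₂) ≤ 28δ`. -/
theorem almost_nearest_point_close_to_other_convex {X : Type*} [MetricSpace X] {δ : ℝ}
    (hδ : 0 ≤ δ) (hgeo : GeodesicSpace X) (hhyp : GromovHyperbolic X δ)
    (C₁ C₂ : Set X) (hconv₁ : GeodConvex C₁) (hconv₂ : GeodConvex C₂)
    (hint : (C₁ ∩ C₂).Nonempty) (z x₁ x₂ : X) (hx₁ : x₁ ∈ C₁) (hx₂ : x₂ ∈ C₂)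
    (hn₁ : dist z x₁ ≤ Metric.infDist z C₁ + δ)
    (hn₂ : dist z x₂ ≤ Metric.infDist z C₂ + δ)
    (h12 : dist z x₁ ≥ dist z x₂ - δ) :
    Metric.infDist x₁ C₂ ≤ 28 * δ := by
  suffices h : Metric.infDist x₁ C₂ ≤ 9 * δ by linarith
  obtain ⟨y, hy₁, hy₂⟩ := hint
  obtain ⟨syz, hyz⟩ := hgeo y z
  obtain ⟨szx, hzx⟩ := hgeo z x₂
  obtain ⟨sxy, hxy⟩ := hgeo x₂ y
  refine le_of_forall_pos_le_add fun ε hε => ?_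
  obtain ⟨r, hr, hxr⟩ := hconv₁.exists_mem_segment_dist_le hδ hgeo hhyp hx₁ hy₁ hn₁ hyz
    (half_pos hε)
  obtain ⟨w, hw | hw, hrw⟩ := (hhyp y z x₂ syz szx sxy hyz hzx hxy).1 r hr
  · have h₁ := Metric.infDist_le_dist_of_mem (x := x₁) hx₂
    linarith [hzx.dist_add_dist hw, dist_triangle4 x₁ r w x₂, dist_triangle4 z w r x₁,
      dist_comm w r, dist_comm r x₁]
  · have h₁ := Metric.infDist_le_dist_of_mem (x := x₁) (hconv₂ x₂ hx₂ y hy₂ sxy hxy hw)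
    linarith [dist_triangle x₁ r w]
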